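/- Let F_n (n≥1) and F be continuous, bounded, Lebesgue-integrable real-valued functions on (0,∞) with F_n ≥ −1 and F ≥ −1, and suppose that ∫₀^∞ e^{−sx}F_n(x)dx → ∫₀^∞ e^{−sx}F(x)dx for every s∈ℂ with Re(s)≥0. Then: (i) for every x>0 and every φ∈ℂ with Re(φ)=0, ∫₀^x e^{φt}F_n(t)dt → ∫₀^x e^{φt}F(t)dt; and (ii) for every c>0 and every φ∈ℂ with Re(φ)=0, ∫₀^∞ e^{φx}F_n(x+c)dx → ∫₀^∞ e^{φx}F(x+c)dx. -/

import Mathlib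

open MeasureTheory Set Filter
open scoped Topology

noncomputable section

/-- admissible test functions: measurable and dominated by a multiple of `exp (-t)` -/
def Adm11 (f : ℝ → ℝ) : Prop :=
  AEStronglyMeasurable f (volume.restrict (Ioi 0)) ∧
    ∃ C, ∀ t ∈ Ioi (0:ℝ), |f t| ≤ C * Real.exp (-t)

/-- convergence of the integrals of `f` against `K n` -/
def Conv11 (K : ℕ → ℝ → ℝ) (L : ℝ → ℝ) (f : ℝ → ℝ) : Prop :=
  Tendsto (fun n => ∫ t in Ioi (0:ℝ), f t * K n t) atTop (𝓝 (∫ t in Ioi (0:ℝ), f t * L t))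

lemma exp_integrable11 : IntegrableOn (fun t : ℝ => Real.exp (-t)) (Ioi 0) :=
  integrableOn_exp_neg_Ioi 0

lemma Adm11.integrable {f : ℝ → ℝ} (hf : Adm11 f) : IntegrableOn f (Ioi 0) := by
  obtain ⟨hm, C, hC⟩ := hf
  refine Integrable.mono' (exp_integrable11.const_mul C) hm ?_
  exact (ae_restrict_mem measurableSet_Ioi).mono fun t ht => hC t ht

lemma Adm11.integrable_mul {f : ℝ → ℝ} (hf : Adm11 f) {F : ℝ → ℝ}
    (hF : IntegrableOn F (Ioi 0)) : IntegrableOn (fun t => f t * F t) (Ioi 0) := by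
  obtain ⟨hm, C, hC⟩ := hf
  refine Integrable.bdd_mul (c := |C|) hF hm ?_
  refine (ae_restrict_mem measurableSet_Ioi).mono fun t ht => ?_
  have h1 : Real.exp (-t) ≤ 1 := Real.exp_le_one_iff.2 (by simpa using le_of_lt ht)
  calc ‖f t‖ ≤ C * Real.exp (-t) := hC t ht
    _ ≤ |C| * 1 := by
      gcongr
      exact le_abs_self C
    _ = |C| := mul_one _

lemma Adm11.integrable_mul_add {f : ℝ → ℝ} (hf : Adm11 f) {F : ℝ → ℝ}
    (hF : IntegrableOn F (Ioi 0)) : IntegrableOn (fun t => f t * (F t + 1)) (Ioi 0) := by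
  refine ((hf.integrable_mul hF).add hf.integrable).congr ?_
  refine Eventually.of_forall fun t => ?_
  simp [mul_add]

lemma conv_of_approx11 {K : ℕ → ℝ → ℝ} {L : ℝ → ℝ}
    (hK : ∀ n, ∀ t ∈ Ioi (0:ℝ), 0 ≤ K n t) (hL : ∀ t ∈ Ioi (0:ℝ), 0 ≤ L t)
    (hKi : ∀ n f, Adm11 f → IntegrableOn (fun t => f t * K n t) (Ioi 0))
    (hLi : ∀ f, Adm11 f → IntegrableOn (fun t => f t * L t) (Ioi 0))
    {f : ℝ → ℝ} (hf : Adm11 f)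
    (h : ∀ ε > 0, ∃ g b : ℝ → ℝ, Adm11 g ∧ Adm11 b ∧ Conv11 K L g ∧ Conv11 K L b ∧
      (∀ t ∈ Ioi (0:ℝ), |f t - g t| ≤ b t) ∧ ∫ t in Ioi (0:ℝ), b t * L t < ε) :
    Conv11 K L f := by
  have key : ∀ (M : ℝ → ℝ), (∀ t ∈ Ioi (0:ℝ), 0 ≤ M t) →
      (∀ f, Adm11 f → IntegrableOn (fun t => f t * M t) (Ioi 0)) →
      ∀ g b : ℝ → ℝ, Adm11 g → Adm11 b → (∀ t ∈ Ioi (0:ℝ), |f t - g t| ≤ b t) →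
      |(∫ t in Ioi (0:ℝ), f t * M t) - ∫ t in Ioi (0:ℝ), g t * M t| ≤
        ∫ t in Ioi (0:ℝ), b t * M t := by
    intro M hM hMi g b hg hb hgb
    rw [← integral_sub (hMi f hf) (hMi g hg), ← Real.norm_eq_abs]
    refine norm_integral_le_of_norm_le (hMi b hb) ?_
    refine (ae_restrict_mem measurableSet_Ioi).mono fun t ht => ?_
    rw [← sub_mul, norm_mul, Real.norm_eq_abs, Real.norm_of_nonneg (hM t ht)]
    exact mul_le_mul_of_nonneg_right (hgb t ht) (hM t ht)
  unfold Conv11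
  rw [Metric.tendsto_atTop]
  intro ε hε
  obtain ⟨g, b, hg, hb, cg, cb, hgb, hbε⟩ := h (ε / 4) (by positivity)
  have e1 := (Metric.tendsto_nhds.1 cg) (ε / 4) (by positivity)
  have e2 : ∀ᶠ n in atTop, ∫ t in Ioi (0:ℝ), b t * K n t < ε / 4 := cb.eventually_lt_const hbε
  obtain ⟨N, hN⟩ := eventually_atTop.1 (e1.and e2)
  refine ⟨N, fun n hn => ?_⟩
  obtain ⟨h1, h2⟩ := hN n hn
  have k1 := key (K n) (hK n) (hKi n) g b hg hb hgb
  have k2 := key L hL hLi g b hg hb hgb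
  rw [Real.dist_eq] at h1 ⊢
  rw [abs_lt] at *
  rw [abs_le] at *
  constructor <;> linarith [k1.1, k1.2, k2.1, k2.2, h1.1, h1.2]

lemma adm_comp11 {g : ℝ → ℝ} (hg : Continuous g) :
    Adm11 (fun t => Real.exp (-t) * g (Real.exp (-t))) := by
  refine ⟨(by fun_prop : Continuous _).aestronglyMeasurable, ?_⟩
  obtain ⟨C, hC⟩ := (isCompact_Icc (a := (0:ℝ)) (b := 1)).exists_bound_of_continuousOn
    hg.continuousOn
  refine ⟨C, fun t ht => ?_⟩
  have h1 : Real.exp (-t) ≤ 1 := Real.exp_le_one_iff.2 (by simpa using le_of_lt ht)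
  rw [abs_mul, abs_of_pos (Real.exp_pos _), mul_comm]
  exact mul_le_mul_of_nonneg_right (hC _ ⟨(Real.exp_pos _).le, h1⟩) (Real.exp_pos _).le

lemma conv_poly11 {K : ℕ → ℝ → ℝ} {L : ℝ → ℝ}
    (hKi : ∀ n f, Adm11 f → IntegrableOn (fun t => f t * K n t) (Ioi 0))
    (hLi : ∀ f, Adm11 f → IntegrableOn (fun t => f t * L t) (Ioi 0))
    (hexp : ∀ k : ℕ, Conv11 K L (fun t => Real.exp (-t) * Real.exp (-t) ^ k))
    (p : Polynomial ℝ) : Conv11 K L (fun t => Real.exp (-t) * p.eval (Real.exp (-t))) := by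
  induction p using Polynomial.induction_on' with
  | add p q hp hq =>
    unfold Conv11 at *
    have e : ∀ M : ℝ → ℝ, (∀ f, Adm11 f → IntegrableOn (fun t => f t * M t) (Ioi 0)) →
        ∫ t in Ioi (0:ℝ), (Real.exp (-t) * (p + q).eval (Real.exp (-t))) * M t =
        (∫ t in Ioi (0:ℝ), (Real.exp (-t) * p.eval (Real.exp (-t))) * M t) +
        ∫ t in Ioi (0:ℝ), (Real.exp (-t) * q.eval (Real.exp (-t))) * M t := by
      intro M hM
      rw [← integral_add (hM _ (adm_comp11 p.continuous)) (hM _ (adm_comp11 q.continuous))]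
      congr 1
      ext t
      simp only [Polynomial.eval_add]
      ring
    simp only [e _ (hKi _), e _ hLi]
    exact hp.add hq
  | monomial k a =>
    have := (hexp k).const_mul a
    unfold Conv11
    simp only [← integral_const_mul] at this
    refine (this.congr fun n => ?_).trans_eq ?_
    · congr 1
      ext t
      simp only [Polynomial.eval_monomial]
      ring
    · congr 2
      ext t
      simp only [Polynomial.eval_monomial]
      ring

lemma conv_cont11 {K : ℕ → ℝ → ℝ} {L : ℝ → ℝ}
    (hK : ∀ n, ∀ t ∈ Ioi (0:ℝ), 0 ≤ K n t) (hL : ∀ t ∈ Ioi (0:ℝ), 0 ≤ L t)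
    (hKi : ∀ n f, Adm11 f → IntegrableOn (fun t => f t * K n t) (Ioi 0))
    (hLi : ∀ f, Adm11 f → IntegrableOn (fun t => f t * L t) (Ioi 0))
    (hexp : ∀ k : ℕ, Conv11 K L (fun t => Real.exp (-t) * Real.exp (-t) ^ k))
    {g : ℝ → ℝ} (hg : Continuous g) :
    Conv11 K L (fun t => Real.exp (-t) * g (Real.exp (-t))) := by
  refine conv_of_approx11 hK hL hKi hLi (adm_comp11 hg) fun ε hε => ?_
  set A := ∫ t in Ioi (0:ℝ), Real.exp (-t) * L t with hA
  have hA0 : 0 ≤ A := setIntegral_nonneg measurableSet_Ioi fun t ht =>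
    mul_nonneg (Real.exp_pos _).le (hL t ht)
  set η := ε / (A + 1) with hη
  have hη0 : 0 < η := by positivity
  obtain ⟨p, hp⟩ := exists_polynomial_near_of_continuousOn 0 1 g hg.continuousOn η hη0
  refine ⟨_, _, adm_comp11 p.continuous, adm_comp11 (Polynomial.C η).continuous,
    conv_poly11 hKi hLi hexp p, conv_poly11 hKi hLi hexp (Polynomial.C η), ?_, ?_⟩
  · intro t ht
    have h1 : Real.exp (-t) ≤ 1 := Real.exp_le_one_iff.2 (by simpa using le_of_lt ht)
    have := hp _ ⟨(Real.exp_pos _).le, h1⟩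
    rw [← mul_sub, abs_mul, abs_of_pos (Real.exp_pos _), abs_sub_comm, Polynomial.eval_C]
    exact mul_le_mul_of_nonneg_left this.le (Real.exp_pos _).le
  · have : ∫ t in Ioi (0:ℝ), Real.exp (-t) * (Polynomial.C η).eval (Real.exp (-t)) * L t
        = η * A := by
      rw [hA, ← integral_const_mul]
      congr 1
      ext t
      simp only [Polynomial.eval_C]
      ring
    rw [this, hη, div_mul_eq_mul_div, div_lt_iff₀ (by positivity)]
    nlinarith

/-- continuous functions vanishing beyond `R` have the form `exp (-t) * g (exp (-t))` -/
lemma exists_form11 {q : ℝ → ℝ} (hq : Continuous q) {R : ℝ} (hR : ∀ t, R ≤ t → q t = 0) :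
    ∃ g : ℝ → ℝ, Continuous g ∧ q = fun t => Real.exp (-t) * g (Real.exp (-t)) := by
  have hc : Continuous (fun y : ℝ => -Real.log (max y (Real.exp (-R)))) := by
    refine (Continuous.log (by fun_prop) fun y => ?_).neg
    exact (lt_of_lt_of_le (Real.exp_pos _) (le_max_right _ _)).ne'
  refine ⟨fun y => Real.exp (-Real.log (max y (Real.exp (-R)))) *
    q (-Real.log (max y (Real.exp (-R)))), (by fun_prop), ?_⟩
  ext t
  beta_reduce
  rcases le_total t R with h | h
  · rw [max_eq_left (Real.exp_le_exp.2 (neg_le_neg h)), Real.log_exp, neg_neg, ← mul_assoc, ← Real.exp_add]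
    simp
  · rw [max_eq_right (Real.exp_le_exp.2 (neg_le_neg h)), Real.log_exp, neg_neg, hR t h, hR R le_rfl]
    simp

lemma conv_ind11 {K : ℕ → ℝ → ℝ} {L : ℝ → ℝ}
    (hK : ∀ n, ∀ t ∈ Ioi (0:ℝ), 0 ≤ K n t) (hL : ∀ t ∈ Ioi (0:ℝ), 0 ≤ L t)
    (hKi : ∀ n f, Adm11 f → IntegrableOn (fun t => f t * K n t) (Ioi 0))
    (hLi : ∀ f, Adm11 f → IntegrableOn (fun t => f t * L t) (Ioi 0))
    (hexp : ∀ k : ℕ, Conv11 K L (fun t => Real.exp (-t) * Real.exp (-t) ^ k))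
    {D : ℝ} (hD : ∀ t ∈ Ioi (0:ℝ), L t ≤ D)
    {h : ℝ → ℝ} (hh : Continuous h) (hb : ∀ t, |h t| ≤ 1) (x : ℝ)
    (hadm : Adm11 ((Ioc 0 x).indicator h)) :
    Conv11 K L ((Ioc 0 x).indicator h) := by
  have hD0 : 0 ≤ D := (hL 1 (by simp)).trans (hD 1 (by simp))
  refine conv_of_approx11 hK hL hKi hLi hadm fun ε hε => ?_
  set δ := ε / (2 * D + 1) / 2 with hδ
  have hδ0 : 0 < δ := by positivity
  set χ : ℝ → ℝ := fun t => max 0 (min 1 (1 - (t - x) / δ)) with hχ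
  set τ : ℝ → ℝ := fun t => max 0 (1 - |t - x| / δ) with hτ
  have hχc : Continuous χ := by fun_prop
  have hτc : Continuous τ := by fun_prop
  obtain ⟨g, gc, hg⟩ := exists_form11 (q := fun t => h t * χ t) (R := x + δ) (by fun_prop) (by
    intro t ht
    have : 1 ≤ (t - x) / δ := by rw [le_div_iff₀ hδ0]; linarith
    have : χ t = 0 := max_eq_left ((min_le_right _ _).trans (by linarith))
    simp [this])
  obtain ⟨b, bc, hb'⟩ := exists_form11 (q := τ) (R := x + δ) (by fun_prop) (by
    intro t ht
    have : 1 ≤ |t - x| / δ := by rw [le_div_iff₀ hδ0]; linarith [le_abs_self (t - x)]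
    exact max_eq_left (by linarith))
  have admb : Adm11 τ := by rw [hb']; exact adm_comp11 bc
  refine ⟨fun t => h t * χ t, τ, ?_, admb, ?_, ?_, ?_, ?_⟩
  · rw [hg]; exact adm_comp11 gc
  · rw [hg]; exact conv_cont11 hK hL hKi hLi hexp gc
  · rw [hb']; exact conv_cont11 hK hL hKi hLi hexp bc
  · intro t ht
    beta_reduce
    rcases le_or_gt t x with h1 | h1
    · have : χ t = 1 := by
        have : (t - x) / δ ≤ 0 := div_nonpos_of_nonpos_of_nonneg (by linarith) hδ0.le
        simp only [hχ]
        rw [min_eq_left (by linarith)]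
        simp
      rw [indicator_of_mem (show t ∈ Ioc 0 x from ⟨ht, h1⟩), this]
      simp [hτ]
    · rw [indicator_of_notMem (fun h => absurd h.2 (not_le.2 h1))]
      have e : χ t = τ t := by
        have : 0 ≤ (t - x) / δ := div_nonneg (by linarith) hδ0.le
        simp only [hχ, hτ]
        rw [min_eq_right (by linarith), abs_of_pos (by linarith)]
      have : 0 ≤ τ t := le_max_left _ _
      rw [e, zero_sub, abs_neg, abs_mul, abs_of_nonneg this]
      exact mul_le_of_le_one_left this (hb t)
  · have hi : IntegrableOn ((Icc (x - δ) (x + δ)).indicator fun _ => D) (Ioi 0) := by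
      apply Integrable.integrableOn
      rw [integrable_indicator_iff measurableSet_Icc]
      simp
    have hi' : Integrable ((Icc (x - δ) (x + δ)).indicator fun _ => D) := by
      rw [integrable_indicator_iff measurableSet_Icc]
      simp
    calc ∫ t in Ioi (0:ℝ), τ t * L t
        ≤ ∫ t in Ioi (0:ℝ), (Icc (x - δ) (x + δ)).indicator (fun _ => D) t := by
          refine setIntegral_mono_on (hLi _ admb) hi measurableSet_Ioi fun t ht => ?_
          by_cases hm : t ∈ Icc (x - δ) (x + δ)
          · rw [indicator_of_mem hm]
            have h0 : 0 ≤ τ t := le_max_left _ _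
            have h1 : τ t ≤ 1 := max_le zero_le_one (by
              have : 0 ≤ |t - x| / δ := by positivity
              linarith)
            calc τ t * L t ≤ 1 * L t := mul_le_mul_of_nonneg_right h1 (hL t ht)
              _ ≤ D := by simpa using hD t ht
          · rw [indicator_of_notMem hm]
            have : τ t = 0 := by
              apply max_eq_left
              have : 1 ≤ |t - x| / δ := by
                rw [le_div_iff₀ hδ0, one_mul]
                by_contra hc
                have := abs_lt.1 (not_le.1 hc)
                exact hm ⟨by linarith, by linarith⟩
              linarith
            simp [this]
      _ ≤ ∫ t, (Icc (x - δ) (x + δ)).indicator (fun _ => D) t :=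
          setIntegral_le_integral hi' (Eventually.of_forall fun t =>
            indicator_nonneg (fun _ _ => hD0) t)
      _ = 2 * δ * D := by
          rw [integral_indicator measurableSet_Icc]
          simp only [integral_const, smul_eq_mul, measureReal_restrict_apply_univ]
          rw [Real.volume_real_Icc_of_le (by linarith)]
          ring
      _ < ε := by
          rw [hδ]
          field_simp
          linarith

/-- the approximation lemma behind (3.22)–(3.28): if the
Laplace transforms of continuous, bounded, integrable functions `F_n ≥ −1` converge
to that of `F ≥ −1` on `{Re s ≥ 0}`, then the truncated transforms on `(0,x]` and the
shifted transforms along purely imaginary `φ` converge as well. -/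
theorem statement_11
    (F : ℕ → ℝ → ℝ) (G : ℝ → ℝ)
    (hFcont : ∀ n, ContinuousOn (F n) (Ioi 0))
    (hFbd : ∀ n, ∃ C, ∀ x ∈ Ioi (0:ℝ), |F n x| ≤ C)
    (hFint : ∀ n, IntegrableOn (F n) (Ioi 0))
    (hFge : ∀ n, ∀ x ∈ Ioi (0:ℝ), -1 ≤ F n x)
    (hGcont : ContinuousOn G (Ioi 0))
    (hGbd : ∃ C, ∀ x ∈ Ioi (0:ℝ), |G x| ≤ C)
    (hGint : IntegrableOn G (Ioi 0))
    (hGge : ∀ x ∈ Ioi (0:ℝ), -1 ≤ G x)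
    (hconv : ∀ s : ℂ, 0 ≤ s.re →
      Tendsto (fun n : ℕ => ∫ x in Ioi (0:ℝ), Complex.exp (-s * (x : ℂ)) * ((F n x : ℝ) : ℂ))
        atTop (𝓝 (∫ x in Ioi (0:ℝ), Complex.exp (-s * (x : ℂ)) * ((G x : ℝ) : ℂ)))) :
    (∀ x : ℝ, 0 < x → ∀ φ : ℂ, φ.re = 0 →
      Tendsto (fun n : ℕ => ∫ t in Ioc (0:ℝ) x, Complex.exp (φ * (t : ℂ)) * ((F n t : ℝ) : ℂ))
        atTop (𝓝 (∫ t in Ioc (0:ℝ) x, Complex.exp (φ * (t : ℂ)) * ((G t : ℝ) : ℂ)))) ∧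
    (∀ c : ℝ, 0 < c → ∀ φ : ℂ, φ.re = 0 →
      Tendsto (fun n : ℕ =>
          ∫ x in Ioi (0:ℝ), Complex.exp (φ * (x : ℂ)) * ((F n (x + c) : ℝ) : ℂ))
        atTop
        (𝓝 (∫ x in Ioi (0:ℝ), Complex.exp (φ * (x : ℂ)) * ((G (x + c) : ℝ) : ℂ)))) := by
  have hKi : ∀ n f, Adm11 f → IntegrableOn (fun t => f t * (F n t + 1)) (Ioi 0) :=
    fun n f hf => hf.integrable_mul_add (hFint n)
  have hLi : ∀ f, Adm11 f → IntegrableOn (fun t => f t * (G t + 1)) (Ioi 0) :=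
    fun f hf => hf.integrable_mul_add hGint
  have hexpF : ∀ k : ℕ, Adm11 (fun t => Real.exp (-t) * Real.exp (-t) ^ k) :=
    fun k => adm_comp11 (continuous_pow k)
  have split : ∀ (f M : ℝ → ℝ), Adm11 f → IntegrableOn M (Ioi 0) →
      ∫ t in Ioi (0:ℝ), f t * (M t + 1) =
        (∫ t in Ioi (0:ℝ), f t * M t) + ∫ t in Ioi (0:ℝ), f t := by
    intro f M hf hM
    rw [← integral_add (hf.integrable_mul hM) hf.integrable]
    congr 1
    ext t
    ring
  have hexp : ∀ k : ℕ, Conv11 (fun n t => F n t + 1) (fun t => G t + 1)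
      (fun t => Real.exp (-t) * Real.exp (-t) ^ k) := by
    intro k
    have e : ∀ M : ℝ → ℝ, (∫ t in Ioi (0:ℝ), Complex.exp (-((k + 1 : ℝ) : ℂ) * (t : ℂ)) *
        ((M t : ℝ) : ℂ)) =
        ((∫ t in Ioi (0:ℝ), Real.exp (-t) * Real.exp (-t) ^ k * M t : ℝ) : ℂ) := by
      intro M
      rw [← integral_complex_ofReal]
      congr 1
      ext t
      rw [← Real.exp_nat_mul, ← Real.exp_add]
      push_cast
      congr 2
      ring
    have h1 := hconv ((k + 1 : ℝ) : ℂ) (by rw [Complex.ofReal_re]; positivity)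
    simp only [e] at h1
    have h2 := (Complex.continuous_re.tendsto _).comp h1
    simp only [Function.comp_def, Complex.ofReal_re] at h2
    unfold Conv11
    simp only [split _ _ (hexpF k) (hFint _), split _ _ (hexpF k) hGint]
    exact h2.add_const _
  obtain ⟨C, hC⟩ := hGbd
  have admI : ∀ (h : ℝ → ℝ), Continuous h → (∀ t, |h t| ≤ 1) → ∀ x : ℝ,
      Adm11 ((Ioc 0 x).indicator h) := by
    intro h hh hb x
    refine ⟨hh.aestronglyMeasurable.indicator measurableSet_Ioc, Real.exp x, fun t ht => ?_⟩
    by_cases hm : t ∈ Ioc 0 x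
    · rw [indicator_of_mem hm, ← Real.exp_add]
      exact (hb t).trans (Real.one_le_exp (by linarith [hm.2]))
    · rw [indicator_of_notMem hm]
      simp only [abs_zero]
      positivity
  have indeq : ∀ (h M : ℝ → ℝ) (x : ℝ),
      ∫ t in Ioi (0:ℝ), (Ioc 0 x).indicator h t * M t = ∫ t in Ioc 0 x, h t * M t := by
    intro h M x
    have : (fun t => (Ioc 0 x).indicator h t * M t) = (Ioc 0 x).indicator (fun t => h t * M t) := by
      ext t
      by_cases hm : t ∈ Ioc 0 x <;> simp [hm]
    rw [this, setIntegral_indicator measurableSet_Ioc,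
      inter_eq_self_of_subset_right Ioc_subset_Ioi_self]
  have real : ∀ (h : ℝ → ℝ), Continuous h → (∀ t, |h t| ≤ 1) → ∀ x : ℝ,
      Tendsto (fun n => ∫ t in Ioc 0 x, h t * F n t) atTop
        (𝓝 (∫ t in Ioc 0 x, h t * G t)) := by
    intro h hh hb x
    have ha := admI h hh hb x
    have h1 : Conv11 (fun n t => F n t + 1) (fun t => G t + 1) ((Ioc 0 x).indicator h) := by
      refine conv_ind11 (D := C + 1) (fun n t ht => ?_) (fun t ht => ?_) hKi hLi hexp
        (fun t ht => ?_) hh hb x ha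
      · linarith [hFge n t ht]
      · linarith [hGge t ht]
      · linarith [le_abs_self (G t), hC t ht]
    unfold Conv11 at h1
    simp only [split _ _ ha (hFint _), split _ _ ha hGint, indeq] at h1
    simpa using h1.sub_const (∫ t in Ioi (0:ℝ), (Ioc 0 x).indicator h t)
  have part1 : ∀ x : ℝ, 0 < x → ∀ φ : ℂ, φ.re = 0 →
      Tendsto (fun n : ℕ => ∫ t in Ioc (0:ℝ) x, Complex.exp (φ * (t : ℂ)) * ((F n t : ℝ) : ℂ))
        atTop (𝓝 (∫ t in Ioc (0:ℝ) x, Complex.exp (φ * (t : ℂ)) * ((G t : ℝ) : ℂ))) := by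
    intro x hx φ hφ
    have e : ∀ M : ℝ → ℝ, IntegrableOn M (Ioi 0) →
        ∫ t in Ioc (0:ℝ) x, Complex.exp (φ * (t : ℂ)) * ((M t : ℝ) : ℂ) =
        ((∫ t in Ioc (0:ℝ) x, Real.cos (φ.im * t) * M t : ℝ) : ℂ) +
        ((∫ t in Ioc (0:ℝ) x, Real.sin (φ.im * t) * M t : ℝ) : ℂ) * Complex.I := by
      intro M hM
      have hM' : IntegrableOn M (Ioc 0 x) := hM.mono_set Ioc_subset_Ioi_self
      have i1 : IntegrableOn (fun t => Real.cos (φ.im * t) * M t) (Ioc 0 x) :=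
        Integrable.bdd_mul (c := 1) hM' (by fun_prop : Continuous _).aestronglyMeasurable
          (Eventually.of_forall fun t => Real.abs_cos_le_one _)
      have i2 : IntegrableOn (fun t => Real.sin (φ.im * t) * M t) (Ioc 0 x) :=
        Integrable.bdd_mul (c := 1) hM' (by fun_prop : Continuous _).aestronglyMeasurable
          (Eventually.of_forall fun t => Real.abs_sin_le_one _)
      rw [← integral_complex_ofReal, ← integral_complex_ofReal, ← integral_mul_const,
        ← integral_add i1.ofReal (i2.ofReal.mul_const _)]
      congr 1
      ext t
      have hφ' : φ * (t : ℂ) = ((φ.im * t : ℝ) : ℂ) * Complex.I := by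
        apply Complex.ext <;> simp [hφ]
      rw [hφ', Complex.exp_mul_I, ← Complex.ofReal_cos, ← Complex.ofReal_sin]
      simp only [Complex.ofReal_mul]
      ring_nf
      try rfl
    simp only [e _ (hFint _), e _ hGint]
    have r1 := real (fun t => Real.cos (φ.im * t)) (by fun_prop)
      (fun t => Real.abs_cos_le_one _) x
    have r2 := real (fun t => Real.sin (φ.im * t)) (by fun_prop)
      (fun t => Real.abs_sin_le_one _) x
    exact ((Complex.continuous_ofReal.tendsto _).comp r1).add
      (((Complex.continuous_ofReal.tendsto _).comp r2).mul_const _)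
  refine ⟨part1, ?_⟩
  intro c hc φ hφ
  have e : ∀ M : ℝ → ℝ, IntegrableOn M (Ioi 0) →
      ∫ x in Ioi (0:ℝ), Complex.exp (φ * (x : ℂ)) * ((M (x + c) : ℝ) : ℂ) =
      Complex.exp (-φ * c) * ((∫ x in Ioi (0:ℝ), Complex.exp (-(-φ) * (x : ℂ)) * ((M x : ℝ) : ℂ)) -
        ∫ t in Ioc (0:ℝ) c, Complex.exp (φ * (t : ℂ)) * ((M t : ℝ) : ℂ)) := by
    intro M hM
    have hi : IntegrableOn (fun t : ℝ => Complex.exp (φ * (t : ℂ)) * ((M t : ℝ) : ℂ)) (Ioi 0) := by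
      refine Integrable.bdd_mul (c := 1) hM.ofReal
        (by fun_prop : Continuous _).aestronglyMeasurable
        (Eventually.of_forall fun t => ?_)
      rw [Complex.norm_exp]
      simp [hφ]
    have hu : ∫ x in Ioi (0:ℝ), Complex.exp (φ * (x : ℂ)) * ((M x : ℝ) : ℂ) =
        (∫ t in Ioc (0:ℝ) c, Complex.exp (φ * (t : ℂ)) * ((M t : ℝ) : ℂ)) +
        ∫ t in Ioi c, Complex.exp (φ * (t : ℂ)) * ((M t : ℝ) : ℂ) := by
      rw [← Ioc_union_Ioi_eq_Ioi hc.le]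
      exact setIntegral_union (Ioc_disjoint_Ioi le_rfl) measurableSet_Ioi
        (hi.mono_set Ioc_subset_Ioi_self) (hi.mono_set (Ioi_subset_Ioi hc.le))
    rw [neg_neg, hu, add_sub_cancel_left, ← integral_const_mul]
    have := (measurePreserving_add_right volume c).setIntegral_preimage_emb
      (measurableEmbedding_addRight c)
      (fun t : ℝ => Complex.exp (-φ * c) * (Complex.exp (φ * (t : ℂ)) * ((M t : ℝ) : ℂ))) (Ioi c)
    have hpre : (fun t : ℝ => t + c) ⁻¹' (Ioi c) = Ioi 0 := by
      ext t
      simp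
    rw [hpre] at this
    rw [← this]
    congr 1
    ext t
    rw [← mul_assoc, ← Complex.exp_add]
    congr 2
    push_cast
    ring
  simp only [e _ (hFint _), e _ hGint]
  exact ((hconv (-φ) (by simp [hφ])).sub (part1 c hc φ hφ)).const_mul _
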